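/- arXiv:1508.04127 — 2 statements merged into one kernel-verified Lean document; each statement's English description precedes it below -/
import Mathlib

section
/- Let A^{(1)}, …, A^{(M)} be measurable subsets of 𝒳 with joint operating point u given by u_i = ∫_{∩_{m=1}^M (A^{(m)})^{i_m}} p(x) dx, let l = (l^{(1)},…,l^{(M)}) be a precision-mode vector, and for y ∈ 𝒴^M set η(y) = Σ_{i∈{0,1}^M} u_i q_i^{l}(y), with Bayes posterior p_y(x) = p(x) q_{i(x)}^{l}(y)/η(y) when η(y) > 0, where i(x)_m = 1 iff x ∈ A^{(m)} (p_y = p when η(y) = 0). Then the one-stage gain H(p) − Σ_{y∈𝒴^M} η(y) H(p_y) − γ Σ_{m=1}^M W^{(m)}(l^{(m)}) equals G(u, l). (Lemma 2 of the paper.) -/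
open MeasureTheory Finset Real

/-- Shannon entropy of a function on a finite set (convention `0 * log 0 = 0`
is automatic since `Real.log 0 = 0`). -/
noncomputable def shannonEntropy {S : Type*} [Fintype S] (f : S → ℝ) : ℝ :=
  -∑ s, f s * Real.log (f s)

/-- `f` is a probability mass function on the finite set `S`. -/
def IsPmf {S : Type*} [Fintype S] (f : S → ℝ) : Prop :=
  (∀ s, 0 ≤ f s) ∧ ∑ s, f s = 1

/-- `φ(u) = 𝓗(Σ_i u_i q_i) − Σ_i u_i 𝓗(q_i)`. -/
noncomputable def phiGen {I Y : Type*} [Fintype I] [Fintype Y]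
    (q : I → Y → ℝ) (u : I → ℝ) : ℝ :=
  shannonEntropy (fun y => ∑ i, u i * q i y) - ∑ i, u i * shannonEntropy (q i)

/-- Differential entropy of a density `p` on the region `X`. -/
noncomputable def diffEntropy {α : Type*} [MeasureSpace α] (X : Set α) (p : α → ℝ) : ℝ :=
  -∫ x in X, p x * Real.log (p x)

/-- The joint (product-channel) pmf on `𝒴^M`. -/
noncomputable def qJoint {M : ℕ} {Y : Type*} (f : Fin M → Bool → Y → ℝ)
    (i : Fin M → Bool) (y : Fin M → Y) : ℝ :=
  ∏ m, f m (i m) (y m)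

/-- The cell `∩_m (A^{(m)})^{i_m}` (`B^1 = B`, `B^0 = X \ B`). -/
def cellM {α : Type*} {M : ℕ} (X : Set α) (A : Fin M → Set α)
    (i : Fin M → Bool) : Set α :=
  ⋂ m, (if i m then A m else X \ A m)

open scoped Classical in
/-- Bayes posterior density for joint sensing. -/
noncomputable def bayesPostM {α : Type*} [MeasureSpace α] {M : ℕ} {Y : Type*} [Fintype Y]
    (X : Set α) (p : α → ℝ) (A : Fin M → Set α)
    (f : Fin M → Bool → Y → ℝ) (y : Fin M → Y) : α → ℝ :=
  if (∑ i : Fin M → Bool, (∫ x in cellM X A i, p x) * qJoint f i y) = 0 then p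
  else fun x =>
    p x * qJoint f (fun m => decide (x ∈ A m)) y /
      (∑ i : Fin M → Bool, (∫ x in cellM X A i, p x) * qJoint f i y)

/-- `G(u, l) = 𝓗(Σ_i u_i q_i^l) − Σ_i u_i 𝓗(q_i^l) − γ Σ_m W^{(m)}(l^{(m)})`. -/
noncomputable def Gjoint {M : ℕ} {Y : Type*} [Fintype Y] {L : Fin M → Type*}
    [∀ m, Fintype (L m)]
    (f : (m : Fin M) → L m → Bool → Y → ℝ) (W : (m : Fin M) → L m → ℝ) (γ : ℝ)
    (u : (Fin M → Bool) → ℝ) (l : (m : Fin M) → L m) : ℝ :=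
  phiGen (qJoint (fun m => f m (l m))) u - γ * ∑ m, W m (l m)

lemma aux_qsum {M : ℕ} {Y : Type*} [Fintype Y] (f : Fin M → Bool → Y → ℝ)
    (hf : ∀ m b, IsPmf (f m b)) (i : Fin M → Bool) : ∑ y, qJoint f i y = 1 := by
  classical
  unfold qJoint
  rw [← Fintype.prod_sum (fun m z => f m (i m) z)]
  exact Finset.prod_eq_one fun m _ => (hf m (i m)).2

lemma aux_mem_cell {α : Type*} {M : ℕ} (hM : 2 ≤ M) (X : Set α) (A : Fin M → Set α)
    (hAX : ∀ m, A m ⊆ X) (i : Fin M → Bool) (x : α) :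
    x ∈ cellM X A i ↔ x ∈ X ∧ ∀ m, (i m = true ↔ x ∈ A m) := by
  simp only [cellM, Set.mem_iInter]
  constructor
  · intro h
    constructor
    · have := h ⟨0, by omega⟩
      split_ifs at this
      · exact hAX _ this
      · exact this.1
    · intro m
      have := h m
      split_ifs at this with hi
      · simp [hi, this]
      · simp [hi, this.2]
  · rintro ⟨hx, h⟩ m
    split_ifs with hi
    · exact (h m).1 hi
    · exact ⟨hx, fun hA => hi ((h m).2 hA)⟩

lemma aux_decomp {d M : ℕ} (hM : 2 ≤ M) (X : Set (Fin d → ℝ)) (hX : MeasurableSet X)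
    (A : Fin M → Set (Fin d → ℝ)) (hAm : ∀ m, MeasurableSet (A m)) (hAX : ∀ m, A m ⊆ X)
    (g : (Fin d → ℝ) → ℝ) (hg : IntegrableOn g X) :
    ∫ x in X, g x = ∑ i : Fin M → Bool, ∫ x in cellM X A i, g x := by
  classical
  have hsub : ∀ i, cellM X A i ⊆ X := fun i x hx => ((aux_mem_cell hM X A hAX i x).1 hx).1
  have hU : X = ⋃ i, cellM X A i := by
    ext x
    simp only [Set.mem_iUnion]
    constructor
    · intro hx
      exact ⟨fun m => decide (x ∈ A m), (aux_mem_cell hM X A hAX _ x).2 ⟨hx, by simp⟩⟩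
    · rintro ⟨i, hi⟩
      exact hsub i hi
  conv_lhs => rw [hU]
  apply integral_iUnion_fintype
  · intro i
    refine MeasurableSet.iInter fun m => ?_
    split_ifs
    · exact hAm m
    · exact hX.diff (hAm m)
  · intro i j hij
    refine Set.disjoint_left.2 fun x hi hj => hij ?_
    funext m
    have h1 := ((aux_mem_cell hM X A hAX i x).1 hi).2 m
    have h2 := ((aux_mem_cell hM X A hAX j x).1 hj).2 m
    exact Bool.eq_iff_iff.2 (h1.trans h2.symm)
  · intro i
    exact hg.mono_set (hsub i)

lemma aux_pt (p q e : ℝ) (he : e ≠ 0) :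
    e * (p * q / e * Real.log (p * q / e))
      = q * (p * Real.log p) + (q * Real.log q - q * Real.log e) * p := by
  by_cases hp : p = 0
  · simp [hp]
  by_cases hq : q = 0
  · simp [hq]
  rw [Real.log_div (mul_ne_zero hp hq) he, Real.log_mul hp hq]
  field_simp
  ring

lemma aux_key {d M : ℕ} (hM : 2 ≤ M) {Y : Type*} [Fintype Y]
    (X : Set (Fin d → ℝ)) (hX : MeasurableSet X)
    (f : Fin M → Bool → Y → ℝ) (hf : ∀ m b, IsPmf (f m b))
    (p : (Fin d → ℝ) → ℝ) (hp0 : ∀ x, 0 ≤ p x)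
    (hp : IntegrableOn p X)
    (hpEnt : IntegrableOn (fun x => p x * Real.log (p x)) X)
    (A : Fin M → Set (Fin d → ℝ)) (hAm : ∀ m, MeasurableSet (A m)) (hAX : ∀ m, A m ⊆ X)
    (y : Fin M → Y)
    (hPost : IntegrableOn (fun x => bayesPostM X p A f y x * Real.log (bayesPostM X p A f y x)) X)
    (e : ℝ) (he : e = ∑ i : Fin M → Bool, (∫ x in cellM X A i, p x) * qJoint f i y) :
    e * diffEntropy X (bayesPostM X p A f y)
      = -∑ i : Fin M → Bool, (qJoint f i y * (∫ x in cellM X A i, p x * Real.log (p x))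
        + (∫ x in cellM X A i, p x) * (qJoint f i y * Real.log (qJoint f i y)))
        + e * Real.log e := by
  classical
  have hsub : ∀ i, cellM X A i ⊆ X := fun i x hx => ((aux_mem_cell hM X A hAX i x).1 hx).1
  have hcm : ∀ i, MeasurableSet (cellM X A i) := by
    intro i
    refine MeasurableSet.iInter fun m => ?_
    split_ifs
    · exact hAm m
    · exact hX.diff (hAm m)
  by_cases h0 : e = 0
  · have hz : ∀ i : Fin M → Bool, (∫ x in cellM X A i, p x) * qJoint f i y = 0 := by
      intro i
      have h1 : ∑ i : Fin M → Bool, (∫ x in cellM X A i, p x) * qJoint f i y = 0 := by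
        rw [← he, h0]
      refine (Finset.sum_eq_zero_iff_of_nonneg ?_).1 h1 i (Finset.mem_univ i)
      intro j _
      exact mul_nonneg (integral_nonneg hp0) (Finset.prod_nonneg fun m _ => (hf m (j m)).1 _)
    rw [h0, Finset.sum_eq_zero]
    · simp
    · intro i _
      rcases mul_eq_zero.1 (hz i) with h | h
      · have h2 := (integral_eq_zero_iff_of_nonneg hp0 (hp.mono_set (hsub i))).1 h
        have h3 : ∫ x in cellM X A i, p x * Real.log (p x) = 0 := by
          apply integral_eq_zero_of_ae
          filter_upwards [h2] with x hx
          simp only [Pi.zero_apply] at hx ⊢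
          simp [hx]
        simp [h, h3]
      · simp [h]
  · have hb : bayesPostM X p A f y
        = fun x => p x * qJoint f (fun m => decide (x ∈ A m)) y / e := by
      unfold bayesPostM
      rw [← he, if_neg h0]
    have hc : ∀ i, e * ∫ x in cellM X A i,
        bayesPostM X p A f y x * Real.log (bayesPostM X p A f y x)
        = qJoint f i y * (∫ x in cellM X A i, p x * Real.log (p x))
          + (qJoint f i y * Real.log (qJoint f i y) - qJoint f i y * Real.log e)
            * ∫ x in cellM X A i, p x := by
      intro i
      rw [← integral_const_mul, ← integral_const_mul, ← integral_const_mul, ← integral_add]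
      · refine setIntegral_congr_fun (hcm i) fun x hx => ?_
        have hi : (fun m => decide (x ∈ A m)) = i := by
          funext m
          have := ((aux_mem_cell hM X A hAX i x).1 hx).2 m
          exact Bool.eq_iff_iff.2 (by simp [this])
        simp only [hb, hi]
        exact aux_pt _ _ _ h0
      · exact (hpEnt.mono_set (hsub i)).const_mul _
      · exact (hp.mono_set (hsub i)).const_mul _
    unfold diffEntropy
    rw [aux_decomp hM X hX A hAm hAX _ hPost, mul_neg, Finset.mul_sum,
      Finset.sum_congr rfl fun i _ => hc i]
    conv_rhs => rw [show e * Real.log e = ∑ i : Fin M → Bool,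
      (∫ x in cellM X A i, p x) * qJoint f i y * Real.log e by rw [← Finset.sum_mul, ← he]]
    rw [← Finset.sum_neg_distrib, ← Finset.sum_neg_distrib, ← Finset.sum_add_distrib]
    exact Finset.sum_congr rfl fun i _ => by ring

/-- **Lemma 2.** The one-stage gain (expected entropy reduction minus the
discounted precision-mode costs) of a joint sensing decision `(A, l)` equals
`G(u, l)`, where `u` is the joint operating point of `A`. -/
theorem one_stage_gain_eq_G
    {d M : ℕ} (hM : 2 ≤ M) {Y : Type*} [Fintype Y] [Nonempty Y]
    {L : Fin M → Type*} [∀ m, Fintype (L m)] [∀ m, Nonempty (L m)]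
    (X : Set (Fin d → ℝ)) (hX : IsCompact X)
    (f : (m : Fin M) → L m → Bool → Y → ℝ) (hf : ∀ m l b, IsPmf (f m l b))
    (W : (m : Fin M) → L m → ℝ) (hW : ∀ m l, 0 ≤ W m l)
    (γ : ℝ) (hγ : 0 ≤ γ)
    (p : (Fin d → ℝ) → ℝ)
    (hp0 : ∀ x, 0 ≤ p x)
    (hpsupp : ∀ x ∉ X, p x = 0)
    (hp1 : ∫ x in X, p x = 1)
    (hpEnt : Integrable (fun x => p x * Real.log (p x)) (volume.restrict X))
    (A : Fin M → Set (Fin d → ℝ))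
    (hAm : ∀ m, MeasurableSet (A m))
    (hAX : ∀ m, A m ⊆ X)
    (l : (m : Fin M) → L m)
    (hPostEnt : ∀ y : Fin M → Y,
      Integrable
        (fun x => bayesPostM X p A (fun m => f m (l m)) y x *
          Real.log (bayesPostM X p A (fun m => f m (l m)) y x))
        (volume.restrict X)) :
    diffEntropy X p -
        (∑ y : Fin M → Y,
          (∑ i : Fin M → Bool,
              (∫ x in cellM X A i, p x) * qJoint (fun m => f m (l m)) i y) *
            diffEntropy X (bayesPostM X p A (fun m => f m (l m)) y)) -
        γ * ∑ m, W m (l m)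
      = Gjoint f W γ (fun i => ∫ x in cellM X A i, p x) l := by
  have hXm : MeasurableSet X := hX.measurableSet
  have hp : IntegrableOn p X := by
    by_contra h
    rw [integral_undef h] at hp1
    exact zero_ne_one hp1
  have hf' : ∀ m b, IsPmf ((fun m => f m (l m)) m b) := fun m b => hf m (l m) b
  unfold Gjoint phiGen shannonEntropy
  rw [Finset.sum_congr rfl fun y _ => aux_key hM X hXm (fun m => f m (l m)) hf' p hp0 hp hpEnt
    A hAm hAX y (hPostEnt y) _ rfl]
  have hs := aux_qsum (fun m => f m (l m)) hf'
  generalize qJoint (fun m => f m (l m)) = q at *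
  unfold diffEntropy
  rw [aux_decomp hM X hXm A hAm hAX _ hpEnt]
  rw [Finset.sum_add_distrib, Finset.sum_neg_distrib, Finset.sum_comm]
  simp only [Finset.sum_add_distrib, ← Finset.sum_mul, ← Finset.mul_sum, hs, one_mul, mul_neg,
    Finset.sum_neg_distrib]
  ring
end

section
/- For each sensor m let (u^{(m)*}, l^{(m)*}) be a maximizer of G^{(m)}(u, l) over [0,1] × 𝓛^{(m)}. Then the pair (u*, l*) with u*_i = Π_{m=1}^M (u^{(m)*})^{i_m} (1 − u^{(m)*})^{1−i_m} and l* = (l^{(1)*}, …, l^{(M)*}) maximizes G(u, l) over all pmfs u on {0,1}^M and mode vectors l, and max_{u,l} G(u, l) = Σ_{m=1}^M max_{u,l} G^{(m)}(u, l). (Proposition 9 of the paper: decoupling of the joint sensing-and-precision-mode optimization into single-sensor problems.) -/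
open Finset Real

/-- Single-sensor gain
`G^{(m)}(u, l) = 𝓗(u f_1^{(m,l)} + (1−u) f_0^{(m,l)}) − u 𝓗(f_1^{(m,l)})
− (1−u) 𝓗(f_0^{(m,l)}) − γ W^{(m)}(l)`. -/
noncomputable def Gsingle {Y : Type*} [Fintype Y] {Lm : Type*}
    (f : Lm → Bool → Y → ℝ) (Wm : Lm → ℝ) (γ : ℝ) (u : ℝ) (l : Lm) : ℝ :=
  shannonEntropy (fun y => u * f l true y + (1 - u) * f l false y)
    - u * shannonEntropy (f l true) - (1 - u) * shannonEntropy (f l false)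
    - γ * Wm l


lemma aux_sum_prod {M : ℕ} {Y : Type*} [Fintype Y] (h : Fin M → Y → ℝ) :
    ∑ x : Fin M → Y, ∏ k, h k (x k) = ∏ k, ∑ y, h k y := by
  classical
  rw [Finset.prod_univ_sum, Fintype.piFinset_univ]

lemma aux_marg {M : ℕ} {Y : Type*} [Fintype Y] (f : Fin M → Y → ℝ)
    (hf : ∀ m, ∑ y, f m y = 1) (m : Fin M) (g : Y → ℝ) :
    ∑ x : Fin M → Y, (∏ k, f k (x k)) * g (x m) = ∑ y, f m y * g y := by
  classical
  have h := aux_sum_prod (fun k y => f k y * (if k = m then g y else 1))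
  simp only [Finset.prod_mul_distrib, Finset.prod_ite_eq', Finset.mem_univ, if_true] at h
  rw [h, Finset.prod_eq_single m]
  · simp
  · intro b _ hb
    simp [hb, hf]
  · simp

lemma aux_entropy_prod {M : ℕ} {Y : Type*} [Fintype Y] (f : Fin M → Y → ℝ)
    (hf : ∀ m, ∑ y, f m y = 1) :
    shannonEntropy (fun x : Fin M → Y => ∏ k, f k (x k)) = ∑ m, shannonEntropy (f m) := by
  unfold shannonEntropy
  rw [Finset.sum_neg_distrib]
  congr 1
  have : ∀ x : Fin M → Y, (∏ k, f k (x k)) * Real.log (∏ k, f k (x k))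
      = ∑ m, (∏ k, f k (x k)) * Real.log (f m (x m)) := by
    intro x
    by_cases h : ∏ k, f k (x k) = 0
    · simp [h]
    · rw [Real.log_prod (fun i hi => Finset.prod_ne_zero_iff.1 h i hi), Finset.mul_sum]
  simp only [this]
  rw [Finset.sum_comm]
  exact Finset.sum_congr rfl fun m _ => aux_marg f hf m (fun y => Real.log (f m y))

lemma aux_gibbs {S : Type*} [Fintype S] (p q : S → ℝ) (hp : IsPmf p) (hq : IsPmf q)
    (h : ∀ s, q s = 0 → p s = 0) :
    shannonEntropy p ≤ -∑ s, p s * Real.log (q s) := by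
  unfold shannonEntropy
  have key : ∀ s, p s * Real.log (q s) - p s * Real.log (p s) ≤ q s - p s := by
    intro s
    rcases (hp.1 s).eq_or_lt with h0 | h0
    · rw [← h0]; simpa using hq.1 s
    · have hq0 : 0 < q s := lt_of_le_of_ne (hq.1 s) (fun e => h0.ne' (h s e.symm))
      have := Real.log_le_sub_one_of_pos (div_pos hq0 h0)
      rw [Real.log_div hq0.ne' h0.ne'] at this
      have h2 := mul_le_mul_of_nonneg_left this h0.le
      have h3 : p s * (q s / p s - 1) = q s - p s := by field_simp
      linarith
  have := Finset.sum_le_sum fun s (_ : s ∈ Finset.univ) => key s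
  rw [Finset.sum_sub_distrib, Finset.sum_sub_distrib, hp.2, hq.2] at this
  linarith

lemma aux_marg_u {M : ℕ} (u : (Fin M → Bool) → ℝ) (hu : ∑ i, u i = 1) (m : Fin M)
    (g : Bool → ℝ) :
    ∑ i, u i * g (i m) = (∑ i, u i * (if i m then 1 else 0)) * g true
      + (1 - ∑ i, u i * (if i m then 1 else 0)) * g false := by
  have : ∀ i, u i * g (i m) = (u i * (if i m then 1 else 0)) * g true
      + (u i - u i * (if i m then 1 else 0)) * g false := by
    intro i
    cases i m <;> simp
  simp only [this]
  rw [Finset.sum_add_distrib, ← Finset.sum_mul, ← Finset.sum_mul, Finset.sum_sub_distrib, hu]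

lemma aux_cond {M : ℕ} {Y : Type*} [Fintype Y] (f : Fin M → Bool → Y → ℝ)
    (hf : ∀ m b, IsPmf (f m b)) (u : (Fin M → Bool) → ℝ) (hu : ∑ i, u i = 1) :
    ∑ i, u i * shannonEntropy (qJoint f i) =
      ∑ m, ((∑ i, u i * (if i m then 1 else 0)) * shannonEntropy (f m true)
      + (1 - ∑ i, u i * (if i m then 1 else 0)) * shannonEntropy (f m false)) := by
  have : ∀ i, shannonEntropy (qJoint f i) = ∑ m, shannonEntropy (f m (i m)) := fun i =>
    aux_entropy_prod (fun m => f m (i m)) (fun m => (hf m (i m)).2)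
  simp only [this, Finset.mul_sum]
  rw [Finset.sum_comm]
  exact Finset.sum_congr rfl fun m _ => aux_marg_u u hu m (fun b => shannonEntropy (f m b))

lemma aux_mix_pmf {Y : Type*} [Fintype Y] (f : Bool → Y → ℝ) (hf : ∀ b, IsPmf (f b))
    (v : ℝ) (hv : v ∈ Set.Icc (0 : ℝ) 1) :
    IsPmf (fun y => v * f true y + (1 - v) * f false y) := by
  refine ⟨fun y => add_nonneg (mul_nonneg hv.1 ((hf _).1 y))
    (mul_nonneg (sub_nonneg.2 hv.2) ((hf _).1 y)), ?_⟩
  rw [Finset.sum_add_distrib, ← Finset.mul_sum, ← Finset.mul_sum, (hf _).2, (hf _).2]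
  ring

lemma aux_v_mem {M : ℕ} (u : (Fin M → Bool) → ℝ) (hu : IsPmf u) (m : Fin M) :
    (∑ i, u i * (if i m then 1 else 0)) ∈ Set.Icc (0 : ℝ) 1 := by
  constructor
  · exact Finset.sum_nonneg fun i _ => mul_nonneg (hu.1 i) (by split_ifs <;> norm_num)
  · refine le_trans (Finset.sum_le_sum fun i _ => ?_) hu.2.le
    have := hu.1 i
    split_ifs <;> simp [this]

lemma aux_upper {M : ℕ} {Y : Type*} [Fintype Y] (f : Fin M → Bool → Y → ℝ)
    (hf : ∀ m b, IsPmf (f m b)) (u : (Fin M → Bool) → ℝ) (hu : IsPmf u)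
    (v : Fin M → ℝ) (hv : ∀ m, v m = ∑ i, u i * (if i m then 1 else 0)) :
    shannonEntropy (fun y => ∑ i, u i * qJoint f i y) ≤
      ∑ m, shannonEntropy (fun y => v m * f m true y + (1 - v m) * f m false y) := by
  have hvm : ∀ m, v m ∈ Set.Icc (0 : ℝ) 1 := fun m => by rw [hv]; exact aux_v_mem u hu m
  have hr := fun m => aux_mix_pmf (f m) (hf m) (v m) (hvm m)
  set r : Fin M → Y → ℝ := fun m y => v m * f m true y + (1 - v m) * f m false y with hrdef
  have hrm : ∀ m y, ∑ i, u i * f m (i m) y = r m y := fun m y => by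
    rw [hrdef]; simp only [hv]; exact aux_marg_u u hu.2 m (fun b => f m b y)
  have hq0 : ∀ i x, 0 ≤ qJoint f i x := fun i x => Finset.prod_nonneg fun m _ => (hf _ _).1 _
  have hz : ∀ (x : Fin M → Y) m, r m (x m) = 0 → ∑ i, u i * qJoint f i x = 0 := by
    intro x m h
    rw [← hrm, Finset.sum_eq_zero_iff_of_nonneg
      (fun i _ => mul_nonneg (hu.1 i) ((hf _ _).1 _))] at h
    refine Finset.sum_eq_zero fun i hi => ?_
    rcases mul_eq_zero.1 (h i hi) with h | h
    · simp [h]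
    · rw [qJoint, Finset.prod_eq_zero (Finset.mem_univ m) h, mul_zero]
  have hp : IsPmf (fun y => ∑ i, u i * qJoint f i y) := by
    refine ⟨fun x => Finset.sum_nonneg fun i _ => mul_nonneg (hu.1 i) (hq0 i x), ?_⟩
    rw [Finset.sum_comm, ← hu.2]
    refine Finset.sum_congr rfl fun i _ => ?_
    rw [← Finset.mul_sum]
    simp only [qJoint]
    rw [aux_sum_prod (fun m => f m (i m))]
    simp [(hf _ _).2]
  have hq : IsPmf (fun x : Fin M → Y => ∏ m, r m (x m)) := by
    refine ⟨fun x => Finset.prod_nonneg fun m _ => (hr m).1 _, ?_⟩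
    rw [aux_sum_prod]
    exact Finset.prod_eq_one fun m _ => (hr m).2
  refine (aux_gibbs _ _ hp hq ?_).trans (le_of_eq ?_)
  · intro x h
    obtain ⟨m, _, h⟩ := Finset.prod_eq_zero_iff.1 h
    exact hz x m h
  · unfold shannonEntropy
    rw [Finset.sum_neg_distrib]
    congr 1
    have : ∀ x : Fin M → Y, (∑ i, u i * qJoint f i x) * Real.log (∏ m, r m (x m))
        = ∑ m, ∑ i, u i * (qJoint f i x * Real.log (r m (x m))) := by
      intro x
      simp only [← mul_assoc, ← Finset.sum_mul]
      rw [← Finset.mul_sum]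
      by_cases h : ∃ m, r m (x m) = 0
      · obtain ⟨m, h⟩ := h
        rw [hz x m h]; simp
      · push Not at h
        rw [Real.log_prod (fun m _ => h m)]
    simp only [this]
    rw [Finset.sum_comm]
    refine Finset.sum_congr rfl fun m _ => ?_
    rw [Finset.sum_comm]
    simp only [← Finset.mul_sum, qJoint]
    have h2 : ∀ i : Fin M → Bool, ∑ x : Fin M → Y, (∏ k, f k (i k) (x k)) * Real.log (r m (x m))
        = ∑ y, f m (i m) y * Real.log (r m y) := fun i =>
      aux_marg (fun k => f k (i k)) (fun k => (hf k (i k)).2) m (fun y => Real.log (r m y))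
    simp only [h2, Finset.mul_sum]
    rw [Finset.sum_comm]
    refine Finset.sum_congr rfl fun y _ => ?_
    change _ = r m y * Real.log (r m y)
    trans (∑ i, u i * f m (i m) y) * Real.log (r m y)
    swap
    · rw [hrm m y]
    rw [Finset.sum_mul]
    exact Finset.sum_congr rfl fun i _ => by ring

lemma aux_prod_pmf {M : ℕ} (us : Fin M → ℝ) (h : ∀ m, us m ∈ Set.Icc (0 : ℝ) 1) :
    IsPmf (fun i : Fin M → Bool => ∏ m, if i m then us m else 1 - us m) := by
  constructor
  · intro i
    refine Finset.prod_nonneg fun m _ => ?_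
    have := h m
    split_ifs
    · exact this.1
    · exact sub_nonneg.2 this.2
  · rw [aux_sum_prod (fun m (b : Bool) => if b then us m else 1 - us m)]
    simp

lemma aux_eq {M : ℕ} {Y : Type*} [Fintype Y] {L : Fin M → Type*} [∀ m, Fintype (L m)]
    (f : (m : Fin M) → L m → Bool → Y → ℝ) (hf : ∀ m l b, IsPmf (f m l b))
    (W : (m : Fin M) → L m → ℝ) (γ : ℝ) (us : Fin M → ℝ) (ls : (m : Fin M) → L m)
    (h : ∀ m, us m ∈ Set.Icc (0 : ℝ) 1) :
    Gjoint f W γ (fun i => ∏ m, if i m then us m else 1 - us m) ls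
      = ∑ m, Gsingle (f m) (W m) γ (us m) (ls m) := by
  have hm : ∀ m, (∑ i : Fin M → Bool, (∏ k, if i k then us k else 1 - us k) *
      (if i m then (1 : ℝ) else 0)) = us m := by
    intro m
    rw [aux_marg (fun k (b : Bool) => if b then us k else 1 - us k) (by simp) m
      (fun b => if b then 1 else 0)]
    simp
  have hmix : (fun y : Fin M → Y => ∑ i : Fin M → Bool,
      (∏ m, if i m then us m else 1 - us m) * qJoint (fun m => f m (ls m)) i y)
      = fun y => ∏ m, (us m * f m (ls m) true (y m) + (1 - us m) * f m (ls m) false (y m)) := by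
    funext y
    simp only [qJoint, ← Finset.prod_mul_distrib]
    rw [aux_sum_prod (fun m (b : Bool) => (if b then us m else 1 - us m) * f m (ls m) b (y m))]
    simp
  unfold Gjoint phiGen Gsingle
  rw [hmix, aux_entropy_prod (fun m y => us m * f m (ls m) true y + (1 - us m) * f m (ls m) false y)
    (fun m => (aux_mix_pmf (f m (ls m)) (hf m (ls m)) (us m) (h m)).2),
    aux_cond _ (fun m b => hf m (ls m) b) _ (aux_prod_pmf us h).2]
  simp only [hm, Finset.sum_sub_distrib, Finset.sum_add_distrib, Finset.mul_sum]
  ring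

/-- **Proposition 9.** If `(u^{(m)*}, l^{(m)*})` maximizes `G^{(m)}` over
`[0,1] × 𝓛^{(m)}` for each sensor `m`, then the product pmf
`u*_i = Π_m (u^{(m)*})^{i_m}(1−u^{(m)*})^{1−i_m}` together with
`l* = (l^{(1)*},…,l^{(M)*})` maximizes `G` over all pmfs on `{0,1}^M` and mode
vectors, and `max G = Σ_m max G^{(m)}`. -/
theorem joint_precision_mode_decouples
    {M : ℕ} (hM : 2 ≤ M) {Y : Type*} [Fintype Y] [Nonempty Y]
    {L : Fin M → Type*} [∀ m, Fintype (L m)] [∀ m, Nonempty (L m)]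
    (f : (m : Fin M) → L m → Bool → Y → ℝ) (hf : ∀ m l b, IsPmf (f m l b))
    (W : (m : Fin M) → L m → ℝ) (hW : ∀ m l, 0 ≤ W m l)
    (γ : ℝ) (hγ : 0 ≤ γ)
    (us : Fin M → ℝ) (ls : (m : Fin M) → L m)
    (husmem : ∀ m, us m ∈ Set.Icc (0 : ℝ) 1)
    (husmax : ∀ m, ∀ v ∈ Set.Icc (0 : ℝ) 1, ∀ l : L m,
      Gsingle (f m) (W m) γ v l ≤ Gsingle (f m) (W m) γ (us m) (ls m)) :
    (fun i : Fin M → Bool => ∏ m, if i m then us m else 1 - us m)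
        ∈ stdSimplex ℝ (Fin M → Bool) ∧
    (∀ u ∈ stdSimplex ℝ (Fin M → Bool), ∀ l : (m : Fin M) → L m,
      Gjoint f W γ u l ≤
        Gjoint f W γ (fun i => ∏ m, if i m then us m else 1 - us m) ls) ∧
    Gjoint f W γ (fun i => ∏ m, if i m then us m else 1 - us m) ls
      = ∑ m, Gsingle (f m) (W m) γ (us m) (ls m) := by
  refine ⟨aux_prod_pmf us husmem, ?_, aux_eq f hf W γ us ls husmem⟩
  intro u hu l
  rw [aux_eq f hf W γ us ls husmem]
  have hu' : IsPmf u := hu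
  refine le_trans ?_ (Finset.sum_le_sum fun m _ =>
    husmax m _ (aux_v_mem u hu' m) (l m))
  have h1 := aux_upper (fun m => f m (l m)) (fun m b => hf m (l m) b) u hu' _ (fun m => rfl)
  have h2 := aux_cond (fun m => f m (l m)) (fun m b => hf m (l m) b) u hu'.2
  unfold Gjoint phiGen Gsingle
  rw [h2]
  simp only [Finset.sum_sub_distrib, Finset.sum_add_distrib, ← Finset.mul_sum]
  linarith
end
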